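/- For any ring R, the following are equivalent: (1) every Gorenstein projective R-module is Gorenstein flat; (2) I^+ ∈ GP(R)^⊥ for every injective right R-module I; (3) F^{++} ∈ GP(R)^⊥ for every flat R-module F. -/

import Mathlib

universe u

open CategoryTheory

/-- `extVanish R n M N` asserts that `Ext_R^n(M, N) = 0`. -/
def extVanish (R : Type u) [Ring R] (n : ℕ) (M N : ModuleCat.{u} R) : Prop :=
  letI := HasDerivedCategory.standard (ModuleCat.{u} R)
  letI : HasExt.{u + 1} (ModuleCat.{u} R) := hasExt_of_hasDerivedCategory _
  Subsingleton (Abelian.Ext M N n)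

/-- A module `G` is Gorenstein projective if there is an exact sequence of projective
modules `⋯ → P i → P (i+1) → ⋯` with `G ≅ Im (d 0)` which stays exact after applying
`Hom_R(−, Q)` for every projective module `Q`. -/
def IsGorensteinProjective (R : Type u) [Ring R] (G : ModuleCat.{u} R) : Prop :=
  ∃ (P : ℤ → ModuleCat.{u} R) (d : ∀ i : ℤ, P i →ₗ[R] P (i + 1)),
    (∀ i, Module.Projective R (P i)) ∧
    (∀ i, LinearMap.range (d i) = LinearMap.ker (d (i + 1))) ∧
    Nonempty (G ≃ₗ[R] LinearMap.range (d 0)) ∧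
    ∀ (Q : ModuleCat.{u} R), Module.Projective R Q →
      ∀ (i : ℤ) (f : P (i + 1) →ₗ[R] Q), f ∘ₗ d i = 0 →
        ∃ g : P (i + 1 + 1) →ₗ[R] Q, g ∘ₗ d (i + 1) = f

/-- A module `G` is Gorenstein injective if there is an exact sequence of injective
modules `⋯ → I i → I (i+1) → ⋯` with `G ≅ Im (d 0)` which stays exact after applying
`Hom_R(E, −)` for every injective module `E`. -/
def IsGorensteinInjective (R : Type u) [Ring R] (G : ModuleCat.{u} R) : Prop :=
  ∃ (I : ℤ → ModuleCat.{u} R) (d : ∀ i : ℤ, I i →ₗ[R] I (i + 1)),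
    (∀ i, Module.Injective R (I i)) ∧
    (∀ i, LinearMap.range (d i) = LinearMap.ker (d (i + 1))) ∧
    Nonempty (G ≃ₗ[R] LinearMap.range (d 0)) ∧
    ∀ (E : ModuleCat.{u} R), Module.Injective R E →
      ∀ (i : ℤ) (f : E →ₗ[R] I (i + 1)), d (i + 1) ∘ₗ f = 0 →
        ∃ g : E →ₗ[R] I i, d i ∘ₗ g = f
open MulOpposite in
/-- The subgroup of `I ⊗[ℤ] M` generated by the elements `(x · r) ⊗ y - x ⊗ (r · y)`,
where `I` is a right `R`-module and `M` is a left `R`-module. -/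
noncomputable def tensorRel (R : Type u) [Ring R] (I M : Type u) [AddCommGroup I] [Module Rᵐᵒᵖ I]
    [AddCommGroup M] [Module R M] : AddSubgroup (TensorProduct ℤ I M) :=
  AddSubgroup.closure
    {z | ∃ (r : R) (x : I) (y : M), z = (op r • x) ⊗ₜ[ℤ] y - x ⊗ₜ[ℤ] (r • y)}

/-- The tensor product `I ⊗_R M` of a right `R`-module `I` with a left `R`-module `M`
over an arbitrary ring `R`, realized as a quotient of `I ⊗[ℤ] M`. -/
noncomputable def RTensor (R : Type u) [Ring R] (I M : Type u) [AddCommGroup I] [Module Rᵐᵒᵖ I]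
    [AddCommGroup M] [Module R M] : Type u :=
  TensorProduct ℤ I M ⧸ tensorRel R I M

noncomputable instance (R : Type u) [Ring R] (I M : Type u) [AddCommGroup I]
    [Module Rᵐᵒᵖ I] [AddCommGroup M] [Module R M] : AddCommGroup (RTensor R I M) :=
  QuotientAddGroup.Quotient.addCommGroup _

open MulOpposite in
/-- The map `I ⊗_R M →+ I ⊗_R M'` induced on tensor products by an `R`-linear map
`f : M →ₗ[R] M'`. -/
noncomputable def RTensor.mapRight (R : Type u) [Ring R] (I : Type u) [AddCommGroup I]
    [Module Rᵐᵒᵖ I] {M M' : Type u} [AddCommGroup M] [Module R M] [AddCommGroup M']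
    [Module R M'] (f : M →ₗ[R] M') : RTensor R I M →+ RTensor R I M' :=
  QuotientAddGroup.map _ _
    (TensorProduct.map (LinearMap.id) f.toAddMonoidHom.toIntLinearMap).toAddMonoidHom
    (by
      refine (AddSubgroup.closure_le _).2 ?_
      rintro z ⟨r, x, y, rfl⟩
      refine AddSubgroup.subset_closure ⟨r, x, f y, ?_⟩
      simp [TensorProduct.map_tmul, map_sub, map_smul])

open MulOpposite in
/-- The map `I ⊗_R M →+ I' ⊗_R M` induced on tensor products by a map of right modules
`f : I →ₗ[Rᵐᵒᵖ] I'`. -/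
noncomputable def RTensor.mapLeft (R : Type u) [Ring R] {I I' : Type u} [AddCommGroup I]
    [Module Rᵐᵒᵖ I] [AddCommGroup I'] [Module Rᵐᵒᵖ I'] (f : I →ₗ[Rᵐᵒᵖ] I')
    (M : Type u) [AddCommGroup M] [Module R M] : RTensor R I M →+ RTensor R I' M :=
  QuotientAddGroup.map _ _
    (TensorProduct.map f.toAddMonoidHom.toIntLinearMap (LinearMap.id)).toAddMonoidHom
    (by
      refine (AddSubgroup.closure_le _).2 ?_
      rintro z ⟨r, x, y, rfl⟩
      refine AddSubgroup.subset_closure ⟨r, f x, y, ?_⟩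
      simp [TensorProduct.map_tmul, map_sub, map_smul])

/-- A left `R`-module `M` over an arbitrary ring `R` is flat if tensoring with `M`
preserves injectivity of maps of right `R`-modules. -/
def IsFlatModule (R : Type u) [Ring R] (M : Type u) [AddCommGroup M] [Module R M] : Prop :=
  ∀ (A B : Type u) [AddCommGroup A] [Module Rᵐᵒᵖ A] [AddCommGroup B] [Module Rᵐᵒᵖ B]
    (f : A →ₗ[Rᵐᵒᵖ] B), Function.Injective f → Function.Injective (RTensor.mapLeft R f M)

/-- A module `M` is Gorenstein flat if there is an exact sequence of flat modules
`⋯ → F i → F (i+1) → ⋯` with `M ≅ Im (d 0)` which stays exact after applying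
`I ⊗_R −` for every injective right `R`-module `I`. -/
def IsGorensteinFlat (R : Type u) [Ring R] (M : ModuleCat.{u} R) : Prop :=
  ∃ (F : ℤ → ModuleCat.{u} R) (d : ∀ i : ℤ, F i →ₗ[R] F (i + 1)),
    (∀ i, IsFlatModule R (F i)) ∧
    (∀ i, LinearMap.range (d i) = LinearMap.ker (d (i + 1))) ∧
    Nonempty (M ≃ₗ[R] LinearMap.range (d 0)) ∧
    ∀ (I : Type u) [AddCommGroup I] [Module Rᵐᵒᵖ I], Module.Injective Rᵐᵒᵖ I →
      ∀ i : ℤ, (RTensor.mapRight R I (d i)).range = (RTensor.mapRight R I (d (i + 1))).ker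
/-- The character module `M⁺ = Hom_ℤ(M, ℚ/ℤ)` of an abelian group `M`. -/
abbrev CharMod (M : Type u) [AddCommGroup M] : Type u := M →+ AddCircle (1 : ℚ)

/-- The character module of a right `R`-module is a left `R`-module via
`(r • f) x = f (x • r)`. -/
noncomputable instance (R : Type u) [Ring R] (I : Type u) [AddCommGroup I]
    [Module Rᵐᵒᵖ I] : Module R (CharMod I) where
  smul r f := AddMonoidHom.comp f (DistribMulAction.toAddMonoidHom I (MulOpposite.op r))
  one_smul f := AddMonoidHom.ext fun x => by
    show f (MulOpposite.op (1 : R) • x) = f x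
    rw [MulOpposite.op_one, one_smul]
  mul_smul r s f := AddMonoidHom.ext fun x => by
    show f (MulOpposite.op (r * s) • x) = f (MulOpposite.op s • MulOpposite.op r • x)
    rw [MulOpposite.op_mul, mul_smul]
  smul_zero r := rfl
  smul_add r f g := rfl
  add_smul r s f := AddMonoidHom.ext fun x => by
    show f (MulOpposite.op (r + s) • x) = f (MulOpposite.op r • x) + f (MulOpposite.op s • x)
    rw [MulOpposite.op_add, add_smul, map_add]
  zero_smul f := AddMonoidHom.ext fun x => by
    show f (MulOpposite.op (0 : R) • x) = 0
    rw [MulOpposite.op_zero, zero_smul, map_zero]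

/-- The character module of a left `R`-module is a right `R`-module via
`(f • r) x = f (r • x)`. -/
noncomputable instance (R : Type u) [Ring R] (M : Type u) [AddCommGroup M]
    [Module R M] : Module Rᵐᵒᵖ (CharMod M) where
  smul r f := AddMonoidHom.comp f (DistribMulAction.toAddMonoidHom M r.unop)
  one_smul f := AddMonoidHom.ext fun x => by
    show f ((1 : Rᵐᵒᵖ).unop • x) = f x
    rw [MulOpposite.unop_one, one_smul]
  mul_smul r s f := AddMonoidHom.ext fun x => by
    show f ((r * s).unop • x) = f (s.unop • r.unop • x)
    rw [MulOpposite.unop_mul, mul_smul]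
  smul_zero r := rfl
  smul_add r f g := rfl
  add_smul r s f := AddMonoidHom.ext fun x => by
    show f ((r + s).unop • x) = f (r.unop • x) + f (s.unop • x)
    rw [MulOpposite.unop_add, add_smul, map_add]
  zero_smul f := AddMonoidHom.ext fun x => by
    show f ((0 : Rᵐᵒᵖ).unop • x) = 0
    rw [MulOpposite.unop_zero, zero_smul, map_zero]


section Ext

variable {C : Type*} [Category C] [Abelian C] [HasExt C]

/-- In a short exact sequence whose middle term has no first extensions by `N`, the third term has
no first extensions by `N` exactly when morphisms from the first term to `N` extend. -/
lemma CategoryTheory.ShortComplex.ShortExact.subsingleton_ext_one_iff {S : ShortComplex C}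
    (hS : S.ShortExact) (N : C) (h₂ : Subsingleton (Abelian.Ext S.X₂ N 1)) :
    Subsingleton (Abelian.Ext S.X₃ N 1) ↔ ∀ f : S.X₁ ⟶ N, ∃ g : S.X₂ ⟶ N, S.f ≫ g = f := by
  constructor
  · intro h f
    obtain ⟨x, hx⟩ := Abelian.Ext.contravariant_sequence_exact₁ hS _ (Abelian.Ext.mk₀ f)
      (add_zero 1) (Subsingleton.elim _ _)
    refine ⟨Abelian.Ext.homEquiv₀ x, Abelian.Ext.homEquiv₀.symm.injective ?_⟩
    change Abelian.Ext.mk₀ _ = Abelian.Ext.mk₀ _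
    rw [← Abelian.Ext.mk₀_comp_mk₀, Abelian.Ext.mk₀_homEquiv₀_apply, hx]
  · intro h
    refine subsingleton_of_forall_eq 0 fun x => ?_
    obtain ⟨y, rfl⟩ := Abelian.Ext.contravariant_sequence_exact₃ hS _ x
      (Subsingleton.elim _ _) (add_zero 1)
    obtain ⟨g, hg⟩ := h (Abelian.Ext.homEquiv₀ y)
    rw [← Abelian.Ext.mk₀_homEquiv₀_apply y, ← hg, ← Abelian.Ext.mk₀_comp_mk₀,
      hS.extClass_comp_assoc]

lemma CategoryTheory.Retract.subsingleton_ext {X Y : C} (r : Retract X Y) (G : C) (n : ℕ)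
    (h : Subsingleton (Abelian.Ext G Y n)) : Subsingleton (Abelian.Ext G X n) := by
  refine subsingleton_of_forall_eq 0 fun x => ?_
  have hx : (x.comp (Abelian.Ext.mk₀ r.i) (add_zero n)).comp (Abelian.Ext.mk₀ r.r)
      (add_zero n) = x := by simp
  rw [← hx, Subsingleton.elim (x.comp (Abelian.Ext.mk₀ r.i) (add_zero n)) 0,
    Abelian.Ext.zero_comp]

end Ext

section ExtVanish

variable {R : Type u} [Ring R]

lemma extVanish_one_of_projective (P N : ModuleCat.{u} R) [Module.Projective R P] :
    extVanish R 1 P N := by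
  let := HasDerivedCategory.standard (ModuleCat.{u} R)
  let : HasExt.{u + 1} (ModuleCat.{u} R) := hasExt_of_hasDerivedCategory _
  exact Abelian.Ext.subsingleton_of_projective P N 0

lemma extVanish_of_leftInverse {n : ℕ} {G M N : ModuleCat.{u} R} (i : M →ₗ[R] N) (r : N →ₗ[R] M)
    (hri : ∀ x, r (i x) = x) (h : extVanish R n G N) : extVanish R n G M := by
  let := HasDerivedCategory.standard (ModuleCat.{u} R)
  let : HasExt.{u + 1} (ModuleCat.{u} R) := hasExt_of_hasDerivedCategory _
  exact Retract.subsingleton_ext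
    ⟨ModuleCat.ofHom i, ModuleCat.ofHom r, ModuleCat.hom_ext (LinearMap.ext hri)⟩ G n h

/-- A dimension-shifting criterion for `Ext¹` along a surjection `π`. -/
lemma extVanish_one_iff_of_surjective {X Z N : ModuleCat.{u} R} (π : X →ₗ[R] Z)
    (hπ : Function.Surjective π) (hX : extVanish R 1 X N) :
    extVanish R 1 Z N ↔
      ∀ f : LinearMap.ker π →ₗ[R] N, ∃ g : X →ₗ[R] N, g ∘ₗ (LinearMap.ker π).subtype = f := by
  let := HasDerivedCategory.standard (ModuleCat.{u} R)
  let : HasExt.{u + 1} (ModuleCat.{u} R) := hasExt_of_hasDerivedCategory _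
  let S : ShortComplex (ModuleCat.{u} R) :=
    ShortComplex.mk (ModuleCat.ofHom (LinearMap.ker π).subtype) (ModuleCat.ofHom π)
      (ModuleCat.hom_ext (LinearMap.ext fun x => x.2))
  have hS : S.ShortExact :=
    { exact := (ShortComplex.ShortExact.moduleCat_exact_iff_function_exact _).2
        (LinearMap.exact_subtype_ker_map π)
      mono_f := (ModuleCat.mono_iff_injective _).2 (Submodule.injective_subtype _)
      epi_g := (ModuleCat.epi_iff_surjective _).2 hπ }
  refine (hS.subsingleton_ext_one_iff N hX).trans ⟨fun h f => ?_, fun h f => ?_⟩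
  · obtain ⟨g, hg⟩ := h (ModuleCat.ofHom f)
    exact ⟨g.hom, congrArg ModuleCat.Hom.hom hg⟩
  · obtain ⟨g, hg⟩ := h f.hom
    exact ⟨ModuleCat.ofHom g, ModuleCat.hom_ext hg⟩

/-- In an exact sequence `X₀ → X₁ → X₂ → Z → 0` with `Ext¹(X₂, N) = 0`, the vanishing of
`Ext¹(Z, N)` amounts to the exactness of `Hom(-, N)` at `X₁`. -/
lemma extVanish_one_iff_of_exact {X₀ X₁ X₂ Z N : ModuleCat.{u} R} (d₀ : X₀ →ₗ[R] X₁)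
    (d₁ : X₁ →ₗ[R] X₂) (π : X₂ →ₗ[R] Z) (h₁ : LinearMap.range d₀ = LinearMap.ker d₁)
    (h₂ : LinearMap.range d₁ = LinearMap.ker π) (hπ : Function.Surjective π)
    (hX : extVanish R 1 X₂ N) :
    extVanish R 1 Z N ↔
      ∀ f : X₁ →ₗ[R] N, f ∘ₗ d₀ = 0 → ∃ g : X₂ →ₗ[R] N, g ∘ₗ d₁ = f := by
  let p : X₁ →ₗ[R] LinearMap.ker π := d₁.codRestrict _ fun x => h₂ ▸ LinearMap.mem_range_self d₁ x
  have hp : Function.Surjective p := by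
    rintro ⟨y, hy⟩
    rw [← h₂] at hy
    obtain ⟨x, rfl⟩ := hy
    exact ⟨x, rfl⟩
  have hpk : LinearMap.ker p = LinearMap.range d₀ := by
    rw [h₁, LinearMap.ker_codRestrict]
  rw [extVanish_one_iff_of_surjective π hπ hX]
  constructor
  · intro h f hf
    have hle : LinearMap.ker p ≤ LinearMap.ker f := by
      rw [hpk]; exact LinearMap.range_le_ker_iff.2 hf
    obtain ⟨g, hg⟩ := h ((Submodule.liftQ _ f hle) ∘ₗ
      (p.quotKerEquivOfSurjective hp).symm.toLinearMap)
    refine ⟨g, LinearMap.ext fun x => ?_⟩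
    have h₃ : (p.quotKerEquivOfSurjective hp).symm (p x) = Submodule.Quotient.mk x :=
      (LinearEquiv.symm_apply_eq _).2 rfl
    have h₄ := LinearMap.congr_fun hg (p x)
    simp only [LinearMap.comp_apply, LinearEquiv.coe_coe, h₃] at h₄
    exact h₄
  · intro h f
    obtain ⟨g, hg⟩ := h (f ∘ₗ p) (LinearMap.ext fun x => by
      have : p (d₀ x) = 0 := by
        rw [← LinearMap.mem_ker, hpk]; exact LinearMap.mem_range_self _ _
      simp [this])
    refine ⟨g, LinearMap.ext fun y => ?_⟩
    obtain ⟨x, rfl⟩ := hp y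
    exact LinearMap.congr_fun hg x

end ExtVanish

section CharMod

variable {R : Type u} [Ring R]

/-- The map `B⁺ → A⁺` induced by a map of right modules `A → B`. -/
noncomputable def CharMod.dualRight {A B : Type u} [AddCommGroup A] [Module Rᵐᵒᵖ A]
    [AddCommGroup B] [Module Rᵐᵒᵖ B] (f : A →ₗ[Rᵐᵒᵖ] B) : CharMod B →ₗ[R] CharMod A where
  toFun c := c.comp f.toAddMonoidHom
  map_add' _ _ := rfl
  map_smul' r c := AddMonoidHom.ext fun x => congrArg c (f.map_smul (MulOpposite.op r) x).symm

/-- The map `B⁺ → A⁺` induced by a map of left modules `A → B`. -/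
noncomputable def CharMod.dualLeft {A B : Type u} [AddCommGroup A] [Module R A]
    [AddCommGroup B] [Module R B] (f : A →ₗ[R] B) : CharMod B →ₗ[Rᵐᵒᵖ] CharMod A where
  toFun c := c.comp f.toAddMonoidHom
  map_add' _ _ := rfl
  map_smul' r c := AddMonoidHom.ext fun x => congrArg c (f.map_smul r.unop x).symm

lemma CharMod.dualRight_surjective {A B : Type u} [AddCommGroup A] [Module Rᵐᵒᵖ A]
    [AddCommGroup B] [Module Rᵐᵒᵖ B] (f : A →ₗ[Rᵐᵒᵖ] B) (hf : Function.Injective f) :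
    Function.Surjective (CharMod.dualRight (R := R) f) :=
  CharacterModule.dual_surjective_of_injective f.toAddMonoidHom.toIntLinearMap hf

lemma CharMod.dualLeft_injective {A B : Type u} [AddCommGroup A] [Module R A]
    [AddCommGroup B] [Module R B] (f : A →ₗ[R] B) (hf : Function.Surjective f) :
    Function.Injective (CharMod.dualLeft f) :=
  CharacterModule.dual_injective_of_surjective f.toAddMonoidHom.toIntLinearMap hf

lemma CharMod.dualLeft_surjective {A B : Type u} [AddCommGroup A] [Module R A]
    [AddCommGroup B] [Module R B] (f : A →ₗ[R] B) (hf : Function.Injective f) :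
    Function.Surjective (CharMod.dualLeft f) :=
  CharacterModule.dual_surjective_of_injective f.toAddMonoidHom.toIntLinearMap hf

/-- Evaluation `I → I⁺⁺` as a map of right modules. -/
noncomputable def CharMod.eval (R : Type u) [Ring R] (I : Type u) [AddCommGroup I]
    [Module Rᵐᵒᵖ I] : I →ₗ[Rᵐᵒᵖ] CharMod (CharMod I) where
  toFun x := AddMonoidHom.eval x
  map_add' x y := map_add _ x y
  map_smul' _ _ := rfl

lemma CharMod.eval_injective (R : Type u) [Ring R] (I : Type u) [AddCommGroup I]
    [Module Rᵐᵒᵖ I] : Function.Injective (CharMod.eval R I) :=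
  (injective_iff_map_eq_zero _).2 fun _ hx =>
    CharacterModule.eq_zero_of_character_apply fun c => DFunLike.congr_fun hx c

variable {I M : Type u} [AddCommGroup I] [Module Rᵐᵒᵖ I] [AddCommGroup M] [Module R M]

/-- Swapping arguments turns a map `M → I⁺` into a map `I → M⁺`. -/
noncomputable def CharMod.flipLeft (h : M →ₗ[R] CharMod I) : I →ₗ[Rᵐᵒᵖ] CharMod M where
  toFun := h.toAddMonoidHom.flip
  map_add' := map_add _
  map_smul' r x := AddMonoidHom.ext fun m => (DFunLike.congr_fun (h.map_smul r.unop m) x).symm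

/-- Swapping arguments turns a map `I → M⁺` into a map `M → I⁺`. -/
noncomputable def CharMod.flipRight (h : I →ₗ[Rᵐᵒᵖ] CharMod M) : M →ₗ[R] CharMod I where
  toFun := h.toAddMonoidHom.flip
  map_add' := map_add _
  map_smul' r m := AddMonoidHom.ext fun x =>
    (DFunLike.congr_fun (h.map_smul (MulOpposite.op r) x) m).symm

/-- The pure tensor `x ⊗ m` in `I ⊗_R M`. -/
noncomputable def RTensor.tmul (R : Type u) [Ring R] {I M : Type u} [AddCommGroup I]
    [Module Rᵐᵒᵖ I] [AddCommGroup M] [Module R M] (x : I) (m : M) : RTensor R I M :=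
  QuotientAddGroup.mk (x ⊗ₜ[ℤ] m)

lemma RTensor.tmul_zero (x : I) : RTensor.tmul R x (0 : M) = 0 :=
  congrArg QuotientAddGroup.mk (TensorProduct.tmul_zero M x)

lemma RTensor.zero_tmul (m : M) : RTensor.tmul R (0 : I) m = 0 :=
  congrArg QuotientAddGroup.mk (TensorProduct.zero_tmul I m)

lemma RTensor.tmul_add (x : I) (m n : M) :
    RTensor.tmul R x (m + n) = RTensor.tmul R x m + RTensor.tmul R x n :=
  congrArg QuotientAddGroup.mk (TensorProduct.tmul_add x m n)

lemma RTensor.add_tmul (x y : I) (m : M) :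
    RTensor.tmul R (x + y) m = RTensor.tmul R x m + RTensor.tmul R y m :=
  congrArg QuotientAddGroup.mk (TensorProduct.add_tmul x y m)

lemma RTensor.op_smul_tmul (r : R) (x : I) (m : M) :
    RTensor.tmul R (MulOpposite.op r • x) m = RTensor.tmul R x (r • m) :=
  (QuotientAddGroup.eq_iff_sub_mem (N := tensorRel R I M)).2
    (AddSubgroup.subset_closure ⟨r, x, m, rfl⟩)

lemma RTensor.addMonoidHom_ext {A : Type*} [AddCommGroup A] {f g : RTensor R I M →+ A}
    (h : ∀ x m, f (RTensor.tmul R x m) = g (RTensor.tmul R x m)) : f = g := by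
  refine QuotientAddGroup.addMonoidHom_ext _ (AddMonoidHom.ext fun z => ?_)
  induction z with
  | zero => simp
  | tmul x m => exact h x m
  | add a b ha hb => rw [map_add, map_add, ha, hb]

/-- The character of `I ⊗_R M` corresponding to a map `M → I⁺`. -/
noncomputable def RTensor.charOfHom (h : M →ₗ[R] CharMod I) : CharMod (RTensor R I M) :=
  QuotientAddGroup.lift (tensorRel R I M)
    (TensorProduct.liftAddHom h.toAddMonoidHom.flip fun r x m => by
      simp) (by
    refine (AddSubgroup.closure_le _).2 ?_
    rintro z ⟨r, x, m, rfl⟩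
    have := DFunLike.congr_fun (h.map_smul r m) x
    simp only [SetLike.mem_coe, AddMonoidHom.mem_ker, map_sub, TensorProduct.liftAddHom_tmul,
      sub_eq_zero]
    exact this.symm)

/-- The map `M → I⁺` corresponding to a character of `I ⊗_R M`. -/
noncomputable def RTensor.homOfChar (c : CharMod (RTensor R I M)) : M →ₗ[R] CharMod I where
  toFun m :=
    { toFun := fun x => c (RTensor.tmul R x m)
      map_zero' := by rw [RTensor.zero_tmul, map_zero]
      map_add' := fun x y => by rw [RTensor.add_tmul, map_add] }
  map_add' m n := AddMonoidHom.ext fun x =>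
    (congrArg c (RTensor.tmul_add x m n)).trans (map_add c _ _)
  map_smul' r m := AddMonoidHom.ext fun x => congrArg c (RTensor.op_smul_tmul r x m).symm

end CharMod

/-- Exactness of additive groups can be tested on characters. -/
lemma AddMonoidHom.range_eq_ker_iff_characters {A B C : Type u} [AddCommGroup A] [AddCommGroup B]
    [AddCommGroup C] (f : A →+ B) (g : B →+ C) (hgf : g.comp f = 0) :
    f.range = g.ker ↔ ∀ χ : CharMod B, χ.comp f = 0 → ∃ ψ : CharMod C, ψ.comp g = χ := by
  constructor
  · intro h χ hχ
    have hle : g.ker ≤ χ.ker := by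
      rw [← h]
      rintro _ ⟨a, rfl⟩
      exact DFunLike.congr_fun hχ a
    obtain ⟨ψ, hψ⟩ := CharacterModule.dual_surjective_of_injective
      (QuotientAddGroup.kerLift g).toIntLinearMap (QuotientAddGroup.kerLift_injective g)
      (QuotientAddGroup.lift g.ker χ hle)
    exact ⟨ψ, AddMonoidHom.ext fun b => DFunLike.congr_fun hψ (QuotientAddGroup.mk b)⟩
  · intro h
    refine le_antisymm ?_ fun b hb => ?_
    · rintro _ ⟨a, rfl⟩
      exact DFunLike.congr_fun hgf a
    · rw [← QuotientAddGroup.eq_zero_iff]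
      refine CharacterModule.eq_zero_of_character_apply fun c => ?_
      obtain ⟨ψ, hψ⟩ := h (AddMonoidHom.comp c (QuotientAddGroup.mk' f.range))
        (AddMonoidHom.ext fun a => by
          have : (QuotientAddGroup.mk' f.range) (f a) = 0 :=
            (QuotientAddGroup.eq_zero_iff _).2 ⟨a, rfl⟩
          exact (congrArg c this).trans (map_zero c))
      have h₁ := DFunLike.congr_fun hψ b
      rw [AddMonoidHom.comp_apply, AddMonoidHom.mem_ker.1 hb, map_zero] at h₁
      exact h₁.symm

section Flat

variable {R : Type u} [Ring R]

/-- Exactness of `I ⊗_R -` on a complex is exactness of `Hom_R(-, I⁺)`. -/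
lemma RTensor.mapRight_exact_iff {I X Y Z : Type u} [AddCommGroup I] [Module Rᵐᵒᵖ I]
    [AddCommGroup X] [Module R X] [AddCommGroup Y] [Module R Y] [AddCommGroup Z] [Module R Z]
    (f : X →ₗ[R] Y) (g : Y →ₗ[R] Z) (hgf : g ∘ₗ f = 0) :
    (RTensor.mapRight R I f).range = (RTensor.mapRight R I g).ker ↔
      ∀ h : Y →ₗ[R] CharMod I, h ∘ₗ f = 0 → ∃ k : Z →ₗ[R] CharMod I, k ∘ₗ g = h := by
  have hcomp : (RTensor.mapRight R I g).comp (RTensor.mapRight R I f) = 0 := by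
    refine RTensor.addMonoidHom_ext fun x m => ?_
    exact (congrArg (RTensor.tmul R x) (LinearMap.congr_fun hgf m)).trans (RTensor.tmul_zero x)
  rw [AddMonoidHom.range_eq_ker_iff_characters _ _ hcomp]
  constructor
  · intro H h hh
    obtain ⟨ψ, hψ⟩ := H (RTensor.charOfHom h) (RTensor.addMonoidHom_ext fun x m =>
      DFunLike.congr_fun (LinearMap.congr_fun hh m) x)
    exact ⟨RTensor.homOfChar ψ, LinearMap.ext fun m => AddMonoidHom.ext fun x =>
      DFunLike.congr_fun hψ (RTensor.tmul R x m)⟩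
  · intro H χ hχ
    obtain ⟨k, hk⟩ := H (RTensor.homOfChar χ) (LinearMap.ext fun m => AddMonoidHom.ext fun x =>
      DFunLike.congr_fun hχ (RTensor.tmul R x m))
    exact ⟨RTensor.charOfHom k, RTensor.addMonoidHom_ext fun x m =>
      DFunLike.congr_fun (LinearMap.congr_fun hk m) x⟩

/-- The character module of a flat module is injective. -/
lemma IsFlatModule.injective_charMod {M : Type u} [AddCommGroup M] [Module R M]
    (hM : IsFlatModule R M) : Module.Injective Rᵐᵒᵖ (CharMod M) where
  out A B _ _ _ _ f hf h := by
    obtain ⟨ψ, hψ⟩ := CharacterModule.dual_surjective_of_injective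
      (RTensor.mapLeft R f M).toIntLinearMap (hM A B f hf)
      (RTensor.charOfHom (CharMod.flipRight h))
    exact ⟨CharMod.flipLeft (RTensor.homOfChar ψ), fun a => AddMonoidHom.ext fun m =>
      DFunLike.congr_fun hψ (RTensor.tmul R a m)⟩

lemma isFlatModule_of_projective (P : Type u) [AddCommGroup P] [Module R P]
    [Module.Projective R P] : IsFlatModule R P := by
  intro A B _ _ _ _ f hf
  refine (injective_iff_map_eq_zero _).2 fun z hz =>
    CharacterModule.eq_zero_of_character_apply fun c => ?_
  obtain ⟨k, hk⟩ := Module.projective_lifting_property (CharMod.dualRight f)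
    (RTensor.homOfChar c) (CharMod.dualRight_surjective f hf)
  have hc : (RTensor.charOfHom k).comp (RTensor.mapLeft R f P) = c :=
    RTensor.addMonoidHom_ext fun x m => DFunLike.congr_fun (LinearMap.congr_fun hk m) x
  rw [← hc]
  exact (congrArg _ hz).trans (map_zero _)

/-- Maps into character modules of right modules extend along the kernel of a surjection onto a
flat module. -/
lemma IsFlatModule.exists_extension_charMod {K X F I : Type u} [AddCommGroup K] [Module R K]
    [AddCommGroup X] [Module R X] [AddCommGroup F] [Module R F] [AddCommGroup I]
    [Module Rᵐᵒᵖ I] (hF : IsFlatModule R F) (ι : K →ₗ[R] X) (π : X →ₗ[R] F)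
    (hι : Function.Injective ι) (hπ : Function.Surjective π)
    (h : LinearMap.range ι = LinearMap.ker π) (f : K →ₗ[R] CharMod I) :
    ∃ g : X →ₗ[R] CharMod I, g ∘ₗ ι = f := by
  obtain ⟨r, hr⟩ := hF.injective_charMod.out (CharMod.dualLeft π)
    (CharMod.dualLeft_injective π hπ) LinearMap.id
  have hπι : ∀ x, π (ι x) = 0 := fun x => LinearMap.congr_fun (LinearMap.range_le_ker_iff.1 h.le) x
  have hsurj : Function.Surjective (CharMod.dualLeft ι) := CharMod.dualLeft_surjective ι hι
  let e : CharMod X →ₗ[Rᵐᵒᵖ] CharMod X := LinearMap.id - CharMod.dualLeft π ∘ₗ r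
  have hker : LinearMap.ker (CharMod.dualLeft ι) ≤ LinearMap.ker e := by
    intro b hb
    obtain ⟨a, ha⟩ := ((AddMonoidHom.range_eq_ker_iff_characters ι.toAddMonoidHom
      π.toAddMonoidHom (AddMonoidHom.ext hπι)).1
        (congrArg Submodule.toAddSubgroup h)) b hb
    have hab : CharMod.dualLeft π a = b := ha
    simp only [LinearMap.mem_ker, e, LinearMap.sub_apply, LinearMap.comp_apply, ← hab, hr]
    simp
  let q := (CharMod.dualLeft ι).quotKerEquivOfSurjective hsurj
  let s : CharMod K →ₗ[Rᵐᵒᵖ] CharMod X := Submodule.liftQ _ e hker ∘ₗ q.symm.toLinearMap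
  have hs : ∀ c, CharMod.dualLeft ι (s c) = c := by
    intro c
    obtain ⟨b, rfl⟩ := hsurj c
    have hq : q.symm (CharMod.dualLeft ι b) = Submodule.Quotient.mk b :=
      (LinearEquiv.symm_apply_eq _).2 rfl
    have hse : s (CharMod.dualLeft ι b) = e b := by
      simp only [s, LinearMap.comp_apply, LinearEquiv.coe_coe, hq]
      exact Submodule.liftQ_apply _ _ _
    have hzero : ∀ a, CharMod.dualLeft ι (CharMod.dualLeft π a) = 0 := fun a =>
      AddMonoidHom.ext fun x => (congrArg a (hπι x)).trans (map_zero a)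
    rw [hse]
    simp [e, hzero]
  exact ⟨CharMod.flipRight (s ∘ₗ CharMod.flipLeft f), LinearMap.ext fun k =>
    AddMonoidHom.ext fun x => DFunLike.congr_fun (hs (CharMod.flipLeft f x)) k⟩

/-- Character modules of right modules are cotorsion. -/
lemma IsFlatModule.extVanish_one_charMod {F : ModuleCat.{u} R} (hF : IsFlatModule R F)
    (I : Type u) [AddCommGroup I] [Module Rᵐᵒᵖ I] :
    extVanish R 1 F (ModuleCat.of R (CharMod I)) := by
  have hπ := Finsupp.linearCombination_id_surjective R F
  refine (extVanish_one_iff_of_surjective (X := ModuleCat.of R (F →₀ R))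
    (Finsupp.linearCombination R id) hπ (extVanish_one_of_projective _ _)).2 fun f => ?_
  exact hF.exists_extension_charMod _ _ (Submodule.injective_subtype _) hπ
    (Submodule.range_subtype _) f

end Flat

section Shift

variable {R : Type u} [Ring R]

/-- The identification of equal-index terms of a family of modules. -/
def LinearEquiv.ofIndexEq (P : ℤ → ModuleCat.{u} R) {a b : ℤ} (h : a = b) : P a ≃ₗ[R] P b :=
  h ▸ LinearEquiv.refl R (P a)

lemma LinearEquiv.ofIndexEq_naturality (P : ℤ → ModuleCat.{u} R)
    (d : ∀ i : ℤ, P i →ₗ[R] P (i + 1)) {a b : ℤ} (h : a = b) (h' : a + 1 = b + 1) (x : P a) :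
    d b (LinearEquiv.ofIndexEq P h x) = LinearEquiv.ofIndexEq P h' (d a x) := by
  subst h; rfl

/-- Every syzygy of a complete projective resolution is Gorenstein projective. -/
lemma isGorensteinProjective_range (P : ℤ → ModuleCat.{u} R) (d : ∀ i : ℤ, P i →ₗ[R] P (i + 1))
    (hP : ∀ i, Module.Projective R (P i))
    (hd : ∀ i, LinearMap.range (d i) = LinearMap.ker (d (i + 1)))
    (hQ : ∀ (Q : ModuleCat.{u} R), Module.Projective R Q →
      ∀ (i : ℤ) (f : P (i + 1) →ₗ[R] Q), f ∘ₗ d i = 0 →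
        ∃ g : P (i + 1 + 1) →ₗ[R] Q, g ∘ₗ d (i + 1) = f) (n : ℤ) :
    IsGorensteinProjective R (ModuleCat.of R (LinearMap.range (d n))) := by
  have hn : ∀ i : ℤ, n + i + 1 = n + (i + 1) := fun i => add_assoc n i 1
  let c : ∀ i : ℤ, P (n + i + 1) ≃ₗ[R] P (n + (i + 1)) := fun i =>
    LinearEquiv.ofIndexEq P (hn i)
  let c' : ∀ i : ℤ, P (n + i + 1 + 1) ≃ₗ[R] P (n + (i + 1) + 1) := fun i =>
    LinearEquiv.ofIndexEq P (congrArg (· + 1) (hn i))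
  have hc : ∀ i x, d (n + (i + 1)) (c i x) = c' i (d (n + i + 1) x) := fun i x =>
    LinearEquiv.ofIndexEq_naturality P d _ _ x
  refine ⟨fun i => P (n + i), fun i => (c i).toLinearMap ∘ₗ d (n + i), fun i => hP _,
    fun i => ?_, ?_, fun Q hQP i f hf => ?_⟩
  · ext y
    obtain ⟨x, rfl⟩ := (c i).surjective y
    have := SetLike.ext_iff.1 (hd (n + i)) x
    simpa [hc] using this
  · have h₀ : n = n + 0 := (add_zero n).symm
    refine ⟨?_⟩
    have : ∀ m, n = m → Nonempty (LinearMap.range (d n) ≃ₗ[R] LinearMap.range (d m)) := by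
      rintro _ rfl
      exact ⟨LinearEquiv.refl _ _⟩
    refine (this _ h₀).some ≪≫ₗ ?_
    exact (c 0).submoduleMap _ ≪≫ₗ LinearEquiv.ofEq _ _ (LinearMap.range_comp _ _).symm
  · obtain ⟨g, hg⟩ := hQ Q hQP (n + i) (f ∘ₗ (c i).toLinearMap) hf
    refine ⟨g ∘ₗ (c' i).symm.toLinearMap ∘ₗ (c (i + 1)).symm.toLinearMap, LinearMap.ext fun y => ?_⟩
    obtain ⟨x, rfl⟩ := (c i).surjective y
    have := LinearMap.congr_fun hg x
    simpa [hc] using this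

end Shift

section Main

variable {R : Type u} [Ring R]

lemma IsGorensteinFlat.extVanish_one_charMod {G : ModuleCat.{u} R} (hG : IsGorensteinFlat R G)
    (I : Type u) [AddCommGroup I] [Module Rᵐᵒᵖ I] (hI : Module.Injective Rᵐᵒᵖ I) :
    extVanish R 1 G (ModuleCat.of R (CharMod I)) := by
  obtain ⟨F, d, hF, hd, ⟨e⟩, hT⟩ := hG
  have key : ∀ n m : ℤ, n + 1 + 1 = m → (G ≃ₗ[R] LinearMap.range (d m)) →
      extVanish R 1 G (ModuleCat.of R (CharMod I)) := by
    rintro n _ rfl e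
    refine (extVanish_one_iff_of_exact (d n) (d (n + 1))
      (e.symm.toLinearMap ∘ₗ (d (n + 1 + 1)).rangeRestrict) (hd n) ?_
      (e.symm.surjective.comp (LinearMap.surjective_rangeRestrict _))
      ((hF _).extVanish_one_charMod I)).2 ?_
    · rw [LinearEquiv.ker_comp, LinearMap.ker_rangeRestrict, hd]
    · exact (RTensor.mapRight_exact_iff _ _ (LinearMap.range_le_ker_iff.1 (hd n).le)).1 (hT I hI n)
  exact key (-2) 0 rfl e

lemma IsGorensteinProjective.isGorensteinFlat
    (H : ∀ (I : Type u) [AddCommGroup I] [Module Rᵐᵒᵖ I], Module.Injective Rᵐᵒᵖ I →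
      ∀ G, IsGorensteinProjective R G → extVanish R 1 G (ModuleCat.of R (CharMod I)))
    {G : ModuleCat.{u} R} (hG : IsGorensteinProjective R G) : IsGorensteinFlat R G := by
  obtain ⟨P, d, hP, hd, e, hQ⟩ := hG
  refine ⟨P, d, fun i => isFlatModule_of_projective _, hd, e, fun I _ _ hI i => ?_⟩
  refine (RTensor.mapRight_exact_iff _ _ (LinearMap.range_le_ker_iff.1 (hd i).le)).2 ?_
  refine (extVanish_one_iff_of_exact (N := ModuleCat.of R (CharMod I)) (d i) (d (i + 1))
    (Z := ModuleCat.of R (LinearMap.range (d (i + 1 + 1))))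
    (d (i + 1 + 1)).rangeRestrict (hd i) ?_
    (LinearMap.surjective_rangeRestrict _) (extVanish_one_of_projective _ _)).1
    (H I hI _ (isGorensteinProjective_range P d hP hd hQ _))
  rw [LinearMap.ker_rangeRestrict, hd]

/-- An injective right module is a direct summand of the character module of a free module. -/
lemma Module.Injective.exists_leftInverse_charMod (I : Type u) [AddCommGroup I] [Module Rᵐᵒᵖ I]
    (hI : Module.Injective Rᵐᵒᵖ I) :
    ∃ (j : I →ₗ[Rᵐᵒᵖ] CharMod (CharMod I →₀ R)) (r : CharMod (CharMod I →₀ R) →ₗ[Rᵐᵒᵖ] I),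
      ∀ x, r (j x) = x := by
  let j := CharMod.dualLeft (Finsupp.linearCombination R (id : CharMod I → CharMod I)) ∘ₗ
    CharMod.eval R I
  obtain ⟨r, hr⟩ := hI.out j ((CharMod.dualLeft_injective _
    (Finsupp.linearCombination_id_surjective R (CharMod I))).comp
    (CharMod.eval_injective R I)) LinearMap.id
  exact ⟨j, r, hr⟩

end Main

/-- For any ring `R`, the following are equivalent:
(1) every Gorenstein projective module is Gorenstein flat;
(2) `I⁺ ∈ GP(R)^⊥` for every injective right `R`-module `I`;
(3) `F⁺⁺ ∈ GP(R)^⊥` for every flat `R`-module `F`. -/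
theorem gorensteinProjective_subset_gorensteinFlat_iff (R : Type u) [Ring R] :
    ((∀ M : ModuleCat.{u} R, IsGorensteinProjective R M → IsGorensteinFlat R M) ↔
      (∀ (I : Type u) [AddCommGroup I] [Module Rᵐᵒᵖ I], Module.Injective Rᵐᵒᵖ I →
        ∀ G, IsGorensteinProjective R G →
          extVanish R 1 G (ModuleCat.of R (CharMod I)))) ∧
    ((∀ (I : Type u) [AddCommGroup I] [Module Rᵐᵒᵖ I], Module.Injective Rᵐᵒᵖ I →
        ∀ G, IsGorensteinProjective R G →
          extVanish R 1 G (ModuleCat.of R (CharMod I))) ↔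
      (∀ (F : Type u) [AddCommGroup F] [Module R F], IsFlatModule R F →
        ∀ G, IsGorensteinProjective R G →
          extVanish R 1 G (ModuleCat.of R (CharMod (CharMod F))))) := by
  refine ⟨⟨fun H I _ _ hI G hG => (H G hG).extVanish_one_charMod I hI,
    fun H M hM => hM.isGorensteinFlat H⟩,
    fun H F _ _ hF G hG => H (CharMod F) hF.injective_charMod G hG, fun H I _ _ hI G hG => ?_⟩
  obtain ⟨j, r, hr⟩ := hI.exists_leftInverse_charMod
  exact extVanish_of_leftInverse (CharMod.dualRight r) (CharMod.dualRight j)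
    (fun c => AddMonoidHom.ext fun x => congrArg c (hr x))
    (H (CharMod I →₀ R) (isFlatModule_of_projective _) G hG)
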